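/- arXiv:1804.10884 — 3 statements merged into one kernel-verified Lean document; each statement's English description precedes it below -/
import Mathlib

section
/- Let A be a unital complex *-algebra, let c : ℤ → A be a CAR family, let g ∈ ℝ with g ≠ 0, and let k, j ∈ ℤ with j ≤ k−3 or j ≥ k+2. Then the anticommutator {g·c_{2j-1} + c_{2j-1}·c_{2j}*·c_{2j+1}, O_k} is zero, where O_k := c_{2k-1}*·(1 − (1/g)·(c_{2k}*·c_{2k+1} + c_{2k-3}·c_{2k-2}*) + (2/g²)·c_{2k-3}·c_{2k-2}*·c_{2k}*·c_{2k+1}). -/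
/-- A CAR family over ℤ in a unital complex *-algebra `A`. -/
def IsCARFamily {A : Type*} [Ring A] [StarRing A] [Algebra ℂ A] (c : ℤ → A) : Prop :=
  (∀ i j : ℤ, star (c i) * c j + c j * star (c i) = if i = j then (1 : A) else 0) ∧
  (∀ i j : ℤ, c i * c j + c j * c i = 0)

/-- The odd local element `O_k` of Sannomiya-Katsura-Nakayama. -/
noncomputable def Ok {A : Type*} [Ring A] [StarRing A] [Algebra ℂ A] (c : ℤ → A) (g : ℝ) (k : ℤ) : A :=
  star (c (2*k-1)) *
    (1 - (1/(g : ℂ)) • (star (c (2*k)) * c (2*k+1) + c (2*k-3) * star (c (2*k-2)))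
       + (2/(g : ℂ)^2) • (c (2*k-3) * star (c (2*k-2)) * star (c (2*k)) * c (2*k+1)))

/-- An element that anticommutes with both factors commutes with their product. -/
theorem Commute.mul_right_of_semiconjBy_neg {A : Type*} [Ring A] {x y z : A}
    (hy : SemiconjBy x y (-y)) (hz : SemiconjBy x z (-z)) : Commute x (y * z) := by
  have h := hy.mul_right hz
  rwa [neg_mul_neg] at h

/-- Creation operators of a CAR family anticommute with each other. -/
theorem IsCARFamily.star_mul_star {A : Type*} [Ring A] [StarRing A] [Algebra ℂ A] {c : ℤ → A}
    (hc : IsCARFamily c) (i j : ℤ) : star (c i) * star (c j) + star (c j) * star (c i) = 0 := by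
  have h := congrArg star (hc.2 j i)
  simpa only [star_add, star_mul, star_zero] using h

/-- An element anticommuting with every mode in the support of `Ok c g k` anticommutes with
`Ok c g k`. -/
theorem semiconjBy_neg_Ok {A : Type*} [Ring A] [StarRing A] [Algebra ℂ A] {c : ℤ → A}
    (g : ℝ) (k : ℤ) {x : A}
    (h1 : SemiconjBy x (star (c (2*k-1))) (-star (c (2*k-1))))
    (h2 : SemiconjBy x (star (c (2*k))) (-star (c (2*k))))
    (h3 : SemiconjBy x (c (2*k+1)) (-c (2*k+1)))
    (h4 : SemiconjBy x (c (2*k-3)) (-c (2*k-3)))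
    (h5 : SemiconjBy x (star (c (2*k-2))) (-star (c (2*k-2)))) :
    SemiconjBy x (Ok c g k) (-Ok c g k) := by
  have hr := Commute.mul_right_of_semiconjBy_neg h2 h3
  have hl := Commute.mul_right_of_semiconjBy_neg h4 h5
  have hlr := hl.mul_right hr
  rw [← mul_assoc] at hlr
  have h := h1.mul_right ((((Commute.one_right x).sub_right
    ((hr.add_right hl).smul_right (1 / (g : ℂ)))).add_right
    (hlr.smul_right (2 / (g : ℂ)^2))))
  rwa [neg_mul] at h

/-- An annihilation operator outside the support of `Ok c g k` anticommutes with `Ok c g k`. -/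
theorem IsCARFamily.semiconjBy_neg_Ok {A : Type*} [Ring A] [StarRing A] [Algebra ℂ A]
    {c : ℤ → A} (hc : IsCARFamily c) (g : ℝ) (k i : ℤ) (hi : i < 2*k-3 ∨ 2*k+1 < i) :
    SemiconjBy (c i) (Ok c g k) (-Ok c g k) := by
  have hs (n : ℤ) (hn : n ≠ i) : SemiconjBy (c i) (star (c n)) (-star (c n)) := by
    have h := hc.1 n i
    rw [if_neg hn, add_comm] at h
    simpa only [SemiconjBy, neg_mul] using eq_neg_of_add_eq_zero_left h
  have ha (n : ℤ) : SemiconjBy (c i) (c n) (-c n) := by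
    simpa only [SemiconjBy, neg_mul] using eq_neg_of_add_eq_zero_left (hc.2 i n)
  exact _root_.semiconjBy_neg_Ok g k (hs _ (by omega)) (hs _ (by omega)) (ha _) (ha _)
    (hs _ (by omega))

/-- A creation operator outside the support of `Ok c g k` anticommutes with `Ok c g k`. -/
theorem IsCARFamily.star_semiconjBy_neg_Ok {A : Type*} [Ring A] [StarRing A] [Algebra ℂ A]
    {c : ℤ → A} (hc : IsCARFamily c) (g : ℝ) (k i : ℤ) (hi : i < 2*k-3 ∨ 2*k+1 < i) :
    SemiconjBy (star (c i)) (Ok c g k) (-Ok c g k) := by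
  have ha (n : ℤ) (hn : i ≠ n) : SemiconjBy (star (c i)) (c n) (-c n) := by
    have h := hc.1 i n
    rw [if_neg hn] at h
    simpa only [SemiconjBy, neg_mul] using eq_neg_of_add_eq_zero_left h
  have hs (n : ℤ) : SemiconjBy (star (c i)) (star (c n)) (-star (c n)) := by
    simpa only [SemiconjBy, neg_mul] using eq_neg_of_add_eq_zero_left (hc.star_mul_star i n)
  exact _root_.semiconjBy_neg_Ok g k (hs _) (hs _) (ha _ (by omega)) (ha _ (by omega)) (hs _)

theorem acomm_supercharge_term_Ok_far {A : Type*} [Ring A] [StarRing A] [Algebra ℂ A]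
    (c : ℤ → A) (hc : IsCARFamily c) (g : ℝ) (hg : g ≠ 0) (k j : ℤ)
    (hjk : j ≤ k - 3 ∨ k + 2 ≤ j) :
    ((g : ℂ) • c (2*j-1) + c (2*j-1) * star (c (2*j)) * c (2*j+1)) * Ok c g k
      + Ok c g k * ((g : ℂ) • c (2*j-1) + c (2*j-1) * star (c (2*j)) * c (2*j+1)) = 0 := by
  have h1 := hc.semiconjBy_neg_Ok g k (2*j-1) (by omega)
  have h2 := hc.star_semiconjBy_neg_Ok g k (2*j) (by omega)
  have h3 := hc.semiconjBy_neg_Ok g k (2*j+1) (by omega)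
  have h2' := h2.neg_right
  rw [neg_neg] at h2'
  have h123 := (h1.mul_left h2').mul_left h3
  have hsmul : SemiconjBy ((g : ℂ) • c (2*j-1)) (Ok c g k) (-Ok c g k) := by
    simp only [SemiconjBy, smul_mul_assoc, mul_smul_comm, h1.eq]
  rw [(hsmul.add_left h123).eq, neg_mul, neg_add_cancel]
end

section
/- Let A be a unital complex *-algebra, let c : ℤ → A be a CAR family, let g ∈ ℝ with g ≠ 0, and let k, l ∈ ℤ with |k − l| > 2. Then O_k*·O_l + O_l·O_k* = 0, where O_k := c_{2k-1}*·(1 − (1/g)·(c_{2k}*·c_{2k+1} + c_{2k-3}·c_{2k-2}*) + (2/g²)·c_{2k-3}·c_{2k-2}*·c_{2k}*·c_{2k+1}). -/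
section Anticommute

variable {A : Type*} [Ring A]

/-- `SemiconjBy y a (-a)` says that `y` and `a` anticommute. -/
theorem semiconjBy_neg_iff_anticommute {y a : A} :
    SemiconjBy y a (-a) ↔ y * a + a * y = 0 := by
  rw [SemiconjBy, neg_mul, eq_neg_iff_add_eq_zero]

theorem commute_mul_of_semiconjBy_neg {y a b : A} (ha : SemiconjBy y a (-a))
    (hb : SemiconjBy y b (-b)) : Commute y (a * b) := by
  have h := ha.mul_right hb
  rwa [neg_mul_neg] at h

theorem semiconjBy_neg_star [StarRing A] {y a : A} (h : SemiconjBy y a (-a)) :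
    SemiconjBy (star a) (star y) (-star y) := by
  rw [semiconjBy_neg_iff_anticommute] at h ⊢
  simpa using congrArg star h

theorem SemiconjBy.neg_comm {y a : A} (h : SemiconjBy y a (-a)) : SemiconjBy a y (-y) := by
  rw [semiconjBy_neg_iff_anticommute] at h ⊢
  rwa [add_comm]

end Anticommute

section CAR

variable {A : Type*} [Ring A] [StarRing A] [Algebra ℂ A] {c : ℤ → A}

theorem semiconjBy_neg_Ok_s6 {y : A} (g : ℝ) {k : ℤ}
    (h : ∀ i ∈ Set.Icc (2 * k - 3) (2 * k + 1), SemiconjBy y (c i) (-c i))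
    (hs : ∀ i ∈ Set.Icc (2 * k - 3) (2 * k + 1), SemiconjBy y (star (c i)) (-star (c i))) :
    SemiconjBy y (Ok c g k) (-Ok c g k) := by
  have hright : Commute y (star (c (2 * k)) * c (2 * k + 1)) :=
    commute_mul_of_semiconjBy_neg (hs _ (by constructor <;> lia)) (h _ (by constructor <;> lia))
  have hleft : Commute y (c (2 * k - 3) * star (c (2 * k - 2))) :=
    commute_mul_of_semiconjBy_neg (h _ (by constructor <;> lia)) (hs _ (by constructor <;> lia))
  have hquartic : Commute y
      (c (2 * k - 3) * star (c (2 * k - 2)) * star (c (2 * k)) * c (2 * k + 1)) := by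
    simpa only [mul_assoc] using hleft.mul_right hright
  rw [Ok, ← neg_mul]
  exact (hs _ (by constructor <;> lia)).mul_right
    (((Commute.one_right y).sub_right ((hright.add_right hleft).smul_right _)).add_right
      (hquartic.smul_right _))

theorem IsCARFamily.semiconjBy_neg (hc : IsCARFamily c) (i j : ℤ) :
    SemiconjBy (c i) (c j) (-c j) :=
  semiconjBy_neg_iff_anticommute.2 (hc.2 i j)

theorem IsCARFamily.semiconjBy_neg_star_left (hc : IsCARFamily c) {i j : ℤ} (hij : i ≠ j) :
    SemiconjBy (star (c i)) (c j) (-c j) :=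
  semiconjBy_neg_iff_anticommute.2 (by simpa [hij] using hc.1 i j)

end CAR

theorem acomm_Ok_star_Ol_far {A : Type*} [Ring A] [StarRing A] [Algebra ℂ A]
    (c : ℤ → A) (hc : IsCARFamily c) (g : ℝ) (hg : g ≠ 0) (k l : ℤ)
    (hkl : 2 < |k - l|) :
    star (Ok c g k) * Ok c g l + Ok c g l * star (Ok c g k) = 0 := by
  have hne : ∀ i ∈ Set.Icc (2 * k - 3) (2 * k + 1), ∀ j ∈ Set.Icc (2 * l - 3) (2 * l + 1),
      i ≠ j := by
    rintro i ⟨hi, hi'⟩ j ⟨hj, hj'⟩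
    rcases lt_abs.1 hkl with h | h <;> lia
  rw [← semiconjBy_neg_iff_anticommute]
  refine semiconjBy_neg_Ok_s6 g (fun j hj ↦ ?_) (fun j hj ↦ ?_)
  · have h : SemiconjBy (star (c j)) (Ok c g k) (-Ok c g k) :=
      semiconjBy_neg_Ok_s6 g (fun i hi ↦ hc.semiconjBy_neg_star_left (hne i hi j hj).symm)
        (fun i _ ↦ semiconjBy_neg_star (hc.semiconjBy_neg i j))
    simpa only [star_star] using semiconjBy_neg_star h
  · have h : SemiconjBy (c j) (Ok c g k) (-Ok c g k) :=
      semiconjBy_neg_Ok_s6 g (fun i _ ↦ hc.semiconjBy_neg j i)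
        (fun i hi ↦ (hc.semiconjBy_neg_star_left (hne i hi j hj)).neg_comm)
    exact semiconjBy_neg_star h
end

section
/- Let A be a unital C*-algebra, let φ : A → ℂ be a state, let g ∈ ℝ, and let Q, o : ℕ → A be sequences of elements and C ≥ 0 a constant such that: (i) φ(Q_n·o_n + o_n·Q_n) = g for all positive n; (ii) ‖o_n‖ ≤ C/√n for all positive n; and (iii) (1/n)·Re φ(Q_n*·Q_n + Q_n·Q_n*) → 0 as n → ∞. Then g = 0. -/
open Filter ComplexOrder

/-- A positive functional built from the condition `0 ≤ φ (star a * a)`. -/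
noncomputable def positiveOfStarMulSelf {A : Type*} [CStarAlgebra A] [PartialOrder A]
    [StarOrderedRing A] (φ : A →ₗ[ℂ] ℂ) (hφ : ∀ a : A, 0 ≤ φ (star a * a)) : A →ₚ[ℂ] ℂ :=
  PositiveLinearMap.mk₀ φ fun a ha => by
    obtain ⟨b, rfl⟩ := CStarAlgebra.nonneg_iff_eq_star_mul_self.mp ha
    exact hφ b

/-- Cauchy-Schwarz for a positive functional, in squared form. -/
lemma PositiveLinearMap.sq_norm_apply_star_mul_le {A : Type*} [CStarAlgebra A] [PartialOrder A]
    [StarOrderedRing A] (f : A →ₚ[ℂ] ℂ) (a b : A) :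
    ‖f (star a * b)‖ ^ 2 ≤ (f (star a * a)).re * (f (star b * b)).re := by
  have h := norm_inner_le_norm (𝕜 := ℂ) (f.toPreGNS a) (f.toPreGNS b)
  have key (x : A) : ‖f.toPreGNS x‖ ^ 2 = (f (star x * x)).re := by
    have := f.preGNS_norm_sq (f.toPreGNS x)
    rw [f.ofPreGNS_toPreGNS] at this
    rw [← this]; norm_cast
  rw [← key, ← key, ← mul_pow]
  exact pow_le_pow_left₀ (norm_nonneg _) h 2

/-- A state satisfies `|φ (a⋆ b)|² ≤ φ (a⋆ a) ‖b‖²`. -/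
lemma sq_norm_state_star_mul_le {A : Type*} [CStarAlgebra A]
    (φ : A →ₗ[ℂ] ℂ) (hφ1 : φ 1 = 1) (hφ : ∀ a : A, 0 ≤ φ (star a * a)) (a b : A) :
    ‖φ (star a * b)‖ ^ 2 ≤ (φ (star a * a)).re * ‖b‖ ^ 2 := by
  let _ := CStarAlgebra.spectralOrder A
  have := CStarAlgebra.spectralOrderedRing A
  let f := positiveOfStarMulSelf φ hφ
  have hf (x : A) : f x = φ x := rfl
  have hle : (φ (star b * b)).re ≤ ‖b‖ ^ 2 := by
    have h := OrderHomClass.mono f (CStarAlgebra.star_mul_le_algebraMap_norm_sq (a := b))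
    rw [hf, hf, IsScalarTower.algebraMap_apply ℝ ℂ A, Algebra.algebraMap_eq_smul_one,
      map_smul, hφ1] at h
    have := (Complex.le_def.mp h).1
    simpa [← Complex.ofReal_pow] using this
  exact (f.sq_norm_apply_star_mul_le a b).trans
    (mul_le_mul_of_nonneg_left hle (Complex.le_def.mp (hφ a)).1)

/-- A state on an anticommutator is controlled by the energy `φ (a⋆ a + a a⋆)`. -/
lemma sq_norm_state_anticommutator_le {A : Type*} [CStarAlgebra A]
    (φ : A →ₗ[ℂ] ℂ) (hφ1 : φ 1 = 1) (hφ : ∀ a : A, 0 ≤ φ (star a * a)) (a b : A) :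
    ‖φ (a * b + b * a)‖ ^ 2 ≤ 2 * (φ (star a * a + a * star a)).re * ‖b‖ ^ 2 := by
  have hab := sq_norm_state_star_mul_le φ hφ1 hφ (star a) b
  have hstar : ‖φ (b * a)‖ ^ 2 ≤ (φ (star a * a)).re * ‖b‖ ^ 2 := by
    let _ := CStarAlgebra.spectralOrder A
    have := CStarAlgebra.spectralOrderedRing A
    have h := sq_norm_state_star_mul_le φ hφ1 hφ a (star b)
    have hs := map_star (positiveOfStarMulSelf φ hφ) (b * a)
    change φ (star (b * a)) = star (φ (b * a)) at hs
    rwa [← star_mul, hs, norm_star, norm_star] at h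
  rw [star_star] at hab
  have htri := norm_add_le (φ (a * b)) (φ (b * a))
  rw [map_add, map_add, Complex.add_re]
  nlinarith [norm_nonneg (φ (a * b) + φ (b * a)), norm_nonneg (φ (a * b)),
    norm_nonneg (φ (b * a)), sq_nonneg (‖φ (a * b)‖ - ‖φ (b * a)‖)]

theorem vanishing_energy_density_forces_g_zero {A : Type*} [CStarAlgebra A]
    (φ : A →ₗ[ℂ] ℂ) (hφ1 : φ 1 = 1) (hφpos : ∀ a : A, 0 ≤ φ (star a * a))
    (g : ℝ) (Q o : ℕ → A) (C : ℝ) (hC : 0 ≤ C)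
    (hsusy : ∀ n : ℕ, 0 < n → φ (Q n * o n + o n * Q n) = (g : ℂ))
    (hnorm : ∀ n : ℕ, 0 < n → ‖o n‖ ≤ C / Real.sqrt n)
    (hdensity : Tendsto (fun n : ℕ =>
        (1/(n : ℝ)) * (φ (star (Q n) * Q n + Q n * star (Q n))).re) atTop (nhds 0)) :
    g = 0 := by
  have hbound : ∀ᶠ n : ℕ in atTop, g ^ 2 ≤
      2 * C ^ 2 * ((1/(n : ℝ)) * (φ (star (Q n) * Q n + Q n * star (Q n))).re) := by
    filter_upwards [eventually_gt_atTop 0] with n hn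
    have h := sq_norm_state_anticommutator_le φ hφ1 hφpos (Q n) (o n)
    rw [hsusy n hn, Complex.norm_real, Real.norm_eq_abs, sq_abs] at h
    have hE : 0 ≤ (φ (star (Q n) * Q n + Q n * star (Q n))).re := by
      have h₁ := (Complex.le_def.mp (hφpos (Q n))).1
      have h₂ := (Complex.le_def.mp (hφpos (star (Q n)))).1
      rw [star_star] at h₂
      rw [map_add, Complex.add_re]
      exact add_nonneg h₁ h₂
    have ho : ‖o n‖ ^ 2 ≤ C ^ 2 / n := by
      have := pow_le_pow_left₀ (norm_nonneg _) (hnorm n hn) 2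
      rwa [div_pow, Real.sq_sqrt (Nat.cast_nonneg n)] at this
    calc g ^ 2 ≤ _ := h
      _ ≤ 2 * (φ (star (Q n) * Q n + Q n * star (Q n))).re * (C ^ 2 / n) := by gcongr
      _ = _ := by ring
  have hlim := hdensity.const_mul (2 * C ^ 2)
  rw [mul_zero] at hlim
  exact pow_eq_zero_iff two_ne_zero |>.mp (le_antisymm (ge_of_tendsto hlim hbound) (sq_nonneg g))
end
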